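/- If x is continued fraction normal and k ≥ 2, then the asymptotic frequency of the pattern [1,1] in the subsequence [0; x_k, x_{2k}, x_{3k}, …] exists and equals γ(C_{[1]} ∩ T^{-k}(C_{[1]})). -/

import Mathlib

open MeasureTheory Filter

noncomputable def gaussMap (x : ℝ) : ℝ := Int.fract x⁻¹

noncomputable def gaussMeasure : Measure ℝ :=
  (volume.restrict (Set.Ioo (0:ℝ) 1)).withDensity
    (fun x => ENNReal.ofReal (1 / ((1 + x) * Real.log 2)))

noncomputable def cfDigit (x : ℝ) (i : ℕ) : ℕ := ⌊(gaussMap^[i] x)⁻¹⌋₊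

def cylinder (w : List ℕ) : Set ℝ :=
  {x | x ∈ Set.Ioo (0:ℝ) 1 ∧ ∀ i < w.length, cfDigit x i = w.getD i 0}

noncomputable def blockCount (x : ℝ) (m : ℕ) (s : List ℕ) (N : ℕ) : ℕ :=
  Nat.card {i : ℕ // i ≤ N ∧ (gaussMap^[m * i] x) ∈ cylinder s}

def CFNormal (x : ℝ) : Prop :=
  ∀ s : List ℕ, s ≠ [] → (∀ a ∈ s, 0 < a) →
    Tendsto (fun n : ℕ => (blockCount x 1 s n : ℝ) / n) atTop
      (nhds (gaussMeasure (cylinder s)).toReal)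

def cfVal : List ℕ → ℚ
  | [] => 0
  | a :: t => 1 / (a + cfVal t)

def cfQ (a : ℕ → ℕ) : ℕ → ℕ
  | 0 => 0
  | 1 => 1
  | (m+2) => a (m+1) * cfQ a (m+1) + cfQ a m

def cfP (a : ℕ → ℕ) : ℕ → ℕ
  | 0 => 1
  | 1 => 0
  | (m+2) => a (m+1) * cfP a (m+1) + cfP a m

/-- The first-digit probabilities under `mobiusMeasure s`, the digit being `n + 1`. -/
noncomputable def digitProb (s : ℝ) (n : ℕ) : ℝ := (1 + s) / ((n + 1 + s) * (n + 2 + s))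

/-- The state after the digit `n + 1`: conditioning on it turns `mobiusMeasure s` into
`mobiusMeasure (digitState s n)`. -/
noncomputable def digitState (s : ℝ) (n : ℕ) : ℝ := 1 / (n + 1 + s)

theorem digitProb_nonneg {s : ℝ} (hs : 0 ≤ s) (n : ℕ) : 0 ≤ digitProb s n := by
  unfold digitProb; positivity

theorem digitState_mem {s : ℝ} (hs : 0 ≤ s) (n : ℕ) : digitState s n ∈ Set.Icc (0 : ℝ) 1 := by
  unfold digitState
  refine ⟨by positivity, (div_le_one (by positivity)).2 ?_⟩
  have : (0 : ℝ) ≤ n := n.cast_nonneg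
  linarith

theorem hasSum_digitProb {s : ℝ} (hs : 0 ≤ s) : HasSum (digitProb s) 1 := by
  rw [hasSum_iff_tendsto_nat_of_nonneg (digitProb_nonneg hs)]
  have h : ∀ n : ℕ, ∑ i ∈ Finset.range n, digitProb s i = 1 - (1 + s) / (n + (1 + s)) := by
    intro n
    induction n with
    | zero => simp [div_self (by positivity : (1 + s) ≠ 0)]
    | succ n ih =>
      rw [Finset.sum_range_succ, ih, digitProb]
      push_cast
      field_simp
      ring
  simp only [h]
  have : Tendsto (fun n : ℕ => (1 + s) / (n + (1 + s))) atTop (nhds 0) :=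
    tendsto_const_nhds.div_atTop
      (tendsto_atTop_add_const_right _ _ tendsto_natCast_atTop_atTop)
  simpa using this.const_sub 1

theorem abs_digitState_sub {s t : ℝ} (hs : 0 ≤ s) (ht : 0 ≤ t) (n : ℕ) :
    |digitState s n - digitState t n| = |s - t| * (1 / ((n + 1 + s) * (n + 1 + t))) := by
  have : digitState s n - digitState t n = (t - s) * (1 / ((n + 1 + s) * (n + 1 + t))) := by
    unfold digitState; field_simp; ring
  rw [this, abs_mul, abs_of_nonneg (a := 1 / _) (by positivity), abs_sub_comm]

theorem abs_digitProb_sub_le {s t : ℝ} (hs : s ∈ Set.Icc (0 : ℝ) 1) (ht : t ∈ Set.Icc (0 : ℝ) 1)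
    (n : ℕ) : |digitProb s n - digitProb t n| ≤
      |s - t| * (digitProb 0 n - if n = 0 then 1 / 4 else 0) := by
  obtain ⟨hs0, hs1⟩ := hs
  obtain ⟨ht0, ht1⟩ := ht
  have hst := mul_nonneg hs0 ht0
  have hst1 : s * t ≤ 1 := mul_le_one₀ hs1 ht0 ht1
  have : digitProb s n - digitProb t n = (s - t) *
      (((n + 1) * n - 1 - s - t - s * t) /
        (((n + 1 + s) * (n + 2 + s)) * ((n + 1 + t) * (n + 2 + t)))) := by
    unfold digitProb; field_simp; ring
  rw [this, abs_mul, abs_div, abs_of_nonneg (a := _ * _) (by positivity)]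
  refine mul_le_mul_of_nonneg_left ?_ (abs_nonneg _)
  rcases Nat.eq_zero_or_pos n with rfl | h
  · have e1 : |((0 : ℕ) + 1) * ((0 : ℕ) : ℝ) - 1 - s - t - s * t| = (1 + s) * (1 + t) := by
      rw [abs_of_nonpos (by simp; nlinarith)]
      simp; ring
    rw [e1, if_pos rfl, div_le_iff₀ (by positivity)]
    norm_num [digitProb]
    have e2 : 4 ≤ (2 + s) * (2 + t) := by nlinarith
    have e3 : 0 ≤ (1 + s) * (1 + t) := by positivity
    nlinarith [mul_le_mul_of_nonneg_left e2 e3]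
  have h1n : (1 : ℝ) ≤ n := by exact_mod_cast h
  unfold digitProb
  rw [if_neg h.ne', sub_zero, div_le_div_iff₀ (by positivity) (by positivity)]
  simp only [add_zero, one_mul]
  have h1 : ((n : ℝ) + 1) * (n + 2) ≤ (n + 1 + s) * (n + 2 + s) :=
    mul_le_mul (by linarith) (by linarith) (by positivity) (by positivity)
  have h2 : ((n : ℝ) + 1 + t) * (n + 2 + t) ≥ (n + 1) * (n + 2) :=
    mul_le_mul (by linarith) (by linarith) (by positivity) (by positivity)
  rw [mul_comm]
  refine mul_le_mul h1 ?_ (abs_nonneg _) (by positivity)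
  rw [abs_le]
  constructor <;> nlinarith

theorem abs_digitState_sub_one_le {t : ℝ} (ht : 0 ≤ t) (n : ℕ) :
    |digitState t n - digitState t 1| ≤ if n = 1 then 0 else 1 / 2 := by
  split_ifs with h
  · simp [h]
  have h2 : |digitState t n - digitState t 1| = |(1 : ℝ) - n| / ((n + 1 + t) * (2 + t)) := by
    rw [← abs_of_nonneg (a := ((n : ℝ) + 1 + t) * (2 + t)) (by positivity), ← abs_div]
    unfold digitState
    congr 1
    push_cast
    field_simp
    ring
  rw [h2, div_le_div_iff₀ (by positivity) (by positivity)]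
  have hn : (0 : ℝ) ≤ n := n.cast_nonneg
  have : |(1 : ℝ) - n| ≤ n + 1 := by rw [abs_le]; constructor <;> linarith
  nlinarith [mul_nonneg hn ht, mul_nonneg ht ht]

/-- One step of the digit chain contracts Lipschitz constants. -/
theorem lipschitz_contraction {F G : ℝ → ℝ} {L : ℝ} (hL : 0 ≤ L)
    (hF : ∀ s ∈ Set.Icc (0 : ℝ) 1, ∀ t ∈ Set.Icc (0 : ℝ) 1, |F s - F t| ≤ L * |s - t|)
    (hG : ∀ s ∈ Set.Icc (0 : ℝ) 1,
      HasSum (fun n => digitProb s n * F (digitState s n)) (G s)) :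
    ∀ s ∈ Set.Icc (0 : ℝ) 1, ∀ t ∈ Set.Icc (0 : ℝ) 1,
      |G s - G t| ≤ 11 / 12 * L * |s - t| := by
  intro s hs t ht
  have hs0 := hs.1
  have ht0 := ht.1
  have hsum := ((hG s hs).sub (hG t ht)).sub
    (((hasSum_digitProb hs0).sub (hasSum_digitProb ht0)).mul_right (F (digitState t 1)))
  rw [sub_self, zero_mul, sub_zero] at hsum
  have hmaj : HasSum (fun n => L * |s - t| * (digitProb s n * (1 / 4) + digitProb 0 n * (1 / 2) +
      ((if n = 0 then 1 / 4 else 0) + (if n = 1 then -1 / 12 else 0))))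
      (L * |s - t| * (1 * (1 / 4) + 1 * (1 / 2) + (1 / 4 + -1 / 12))) :=
    ((((hasSum_digitProb hs0).mul_right _).add
      ((hasSum_digitProb le_rfl).mul_right _)).add
      ((hasSum_ite_eq 0 _).add (hasSum_ite_eq 1 _))).mul_left _
  have hle := hsum.norm_le_of_bounded hmaj ?_
  · rw [Real.norm_eq_abs] at hle
    refine hle.trans (le_of_eq ?_)
    ring
  intro n
  rw [Real.norm_eq_abs]
  set v := digitState t 1
  have hid : digitProb s n * F (digitState s n) - digitProb t n * F (digitState t n) -
      (digitProb s n - digitProb t n) * F v =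
      digitProb s n * (F (digitState s n) - F (digitState t n)) +
      (digitProb s n - digitProb t n) * (F (digitState t n) - F v) := by ring
  rw [hid]
  refine (abs_add_le _ _).trans ?_
  rw [abs_mul, abs_mul, abs_of_nonneg (digitProb_nonneg hs0 n)]
  have h1 : digitProb s n * |F (digitState s n) - F (digitState t n)| ≤
      L * |s - t| * (digitProb s n * (1 / ((n + 1 + s) * (n + 1 + t)))) := by
    calc _ ≤ digitProb s n * (L * |digitState s n - digitState t n|) := by
          gcongr
          · exact digitProb_nonneg hs0 n
          · exact hF _ (digitState_mem hs0 n) _ (digitState_mem ht0 n)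
      _ = _ := by rw [abs_digitState_sub hs0 ht0]; ring
  have h2 : |digitProb s n - digitProb t n| * |F (digitState t n) - F v| ≤
      L * |s - t| * ((digitProb 0 n - if n = 0 then 1 / 4 else 0) *
        (if n = 1 then 0 else 1 / 2)) := by
    have hnn : 0 ≤ digitProb 0 n - if n = 0 then 1 / 4 else 0 := by
      split_ifs with h
      · subst h; norm_num [digitProb]
      · simpa using digitProb_nonneg le_rfl n
    calc _ ≤ (|s - t| * (digitProb 0 n - if n = 0 then 1 / 4 else 0)) *
        (L * (if n = 1 then 0 else 1 / 2)) := by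
          refine mul_le_mul (abs_digitProb_sub_le hs ht n) ?_ (abs_nonneg _)
            (mul_nonneg (abs_nonneg _) hnn)
          refine (hF _ (digitState_mem ht0 n) _ (digitState_mem ht0 1)).trans ?_
          gcongr
          exact abs_digitState_sub_one_le ht0 n
      _ = _ := by ring
  refine (add_le_add h1 h2).trans ?_
  rw [← mul_add]
  refine mul_le_mul_of_nonneg_left ?_ (by positivity)
  rcases n with _ | _ | n
  · have e1 : digitProb s 0 = (2 + s)⁻¹ := by
      unfold digitProb; norm_num; field_simp
    have e2 : (2 + s)⁻¹ ≤ 1 / 2 := by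
      rw [inv_le_comm₀ (by positivity) (by norm_num)]
      linarith
    have e3 : 1 / ((1 + s) * (1 + t)) ≤ 1 := by
      rw [div_le_one (by positivity)]
      nlinarith [mul_nonneg hs0 ht0]
    have e4 : digitProb 0 0 = 1 / 2 := by norm_num [digitProb]
    have e5 := mul_le_mul_of_nonneg_left e3 (by positivity : 0 ≤ (2 + s)⁻¹)
    simp only [e1, e4, Nat.cast_zero, zero_add]
    norm_num at e5 ⊢
    linarith
  · have e3 : 1 / ((2 + s) * (2 + t)) ≤ 1 / 4 := by
      apply one_div_le_one_div_of_le (by norm_num)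
      nlinarith [mul_nonneg hs0 ht0]
    have e4 := mul_le_mul_of_nonneg_left e3 (digitProb_nonneg hs0 1)
    have e5 : digitProb 0 1 = 1 / 6 := by unfold digitProb; norm_num
    norm_num [e5] at e4 ⊢
    exact e4
  · have hn : (0 : ℝ) ≤ n := n.cast_nonneg
    have e3 : 1 / (((n + 1 + 1 : ℕ) + 1 + s) * ((n + 1 + 1 : ℕ) + 1 + t)) ≤ 1 / 4 := by
      apply one_div_le_one_div_of_le (by norm_num)
      push_cast
      nlinarith [mul_nonneg hs0 ht0, mul_nonneg hn hs0, mul_nonneg hn ht0]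
    have e4 := mul_le_mul_of_nonneg_left e3 (digitProb_nonneg hs0 (n + 1 + 1))
    simpa using e4

/-- The law on `(0, 1)` of a number whose conditioning past is encoded by `s`. -/
noncomputable def mobiusMeasure (s : ℝ) : Measure ℝ :=
  (volume.restrict (Set.Ioo (0 : ℝ) 1)).withDensity
    (fun x => ENNReal.ofReal ((1 + s) / (1 + s * x) ^ 2))

/-- Numbers with first digit `n + 1`. -/
def digitSet (n : ℕ) : Set ℝ := {x | cfDigit x 0 = n + 1}

theorem measurable_gaussMap : Measurable gaussMap := measurable_inv.fract

theorem measurable_cfDigit (i : ℕ) : Measurable fun x => cfDigit x i :=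
  Nat.measurable_floor.comp (measurable_gaussMap.iterate i).inv

theorem measurableSet_digitSet (n : ℕ) : MeasurableSet (digitSet n) :=
  measurable_cfDigit 0 (measurableSet_singleton (n + 1))

theorem mobiusMeasure_apply (s : ℝ) {D : Set ℝ} (hD : MeasurableSet D) :
    mobiusMeasure s D =
      ∫⁻ x in D ∩ Set.Ioo 0 1, ENNReal.ofReal ((1 + s) / (1 + s * x) ^ 2) := by
  rw [mobiusMeasure, withDensity_apply _ hD, Measure.restrict_restrict hD]

theorem digitSet_inter_preimage (n : ℕ) (D : Set ℝ) :
    (digitSet n ∩ gaussMap ⁻¹' D) ∩ Set.Ioc 0 1 =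
      (fun y : ℝ => ((n : ℝ) + 1 + y)⁻¹) '' (D ∩ Set.Ico 0 1) := by
  ext x
  simp only [digitSet, cfDigit, Function.iterate_zero, id_eq, gaussMap, Set.mem_inter_iff,
    Set.mem_ofPred_eq, Set.mem_preimage, Set.mem_image, Set.mem_Ioc, Set.mem_Ico]
  constructor
  · rintro ⟨⟨h1, h2⟩, h3, h4⟩
    refine ⟨Int.fract x⁻¹, ⟨h2, Int.fract_nonneg _, Int.fract_lt_one _⟩, ?_⟩
    have h5 : (⌊x⁻¹⌋ : ℝ) = n + 1 := by
      rw [← natCast_floor_eq_intCast_floor (inv_nonneg.2 h3.le), h1]; push_cast; rfl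
    rw [← h5, Int.floor_add_fract, inv_inv]
  · rintro ⟨y, ⟨h1, h2, h3⟩, rfl⟩
    have hn : (0 : ℝ) ≤ n := n.cast_nonneg
    have h4 : (n : ℝ) + 1 + y = ((n + 1 : ℕ) : ℝ) + y := by push_cast; rfl
    have h6 : Int.fract ((n : ℝ) + 1 + y) = y := by
      rw [h4, Int.fract_natCast_add, Int.fract_eq_self.2 ⟨h2, h3⟩]
    rw [inv_inv, h6]
    refine ⟨⟨?_, h1⟩, by positivity, inv_le_one_of_one_le₀ (by linarith)⟩
    rw [h4, Nat.floor_eq_iff (by positivity)]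
    constructor <;> linarith

theorem mobiusMeasure_digitSet_inter {s : ℝ} (hs : 0 ≤ s) (n : ℕ) {D : Set ℝ}
    (hD : MeasurableSet D) :
    mobiusMeasure s (digitSet n ∩ gaussMap ⁻¹' D) =
      ENNReal.ofReal (digitProb s n) * mobiusMeasure (digitState s n) D := by
  have hE : MeasurableSet (digitSet n ∩ gaussMap ⁻¹' D) :=
    (measurableSet_digitSet n).inter (measurable_gaussMap hD)
  have hIoc : ((digitSet n ∩ gaussMap ⁻¹' D) ∩ Set.Ioo 0 1 : Set ℝ) =ᵐ[volume]
      ((digitSet n ∩ gaussMap ⁻¹' D) ∩ Set.Ioc 0 1 : Set ℝ) :=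
    ae_eq_set_inter EventuallyEq.rfl Ioo_ae_eq_Ioc
  have hIco : (D ∩ Set.Ioo 0 1 : Set ℝ) =ᵐ[volume] (D ∩ Set.Ico 0 1 : Set ℝ) :=
    ae_eq_set_inter EventuallyEq.rfl Ioo_ae_eq_Ico
  rw [mobiusMeasure_apply _ hE, mobiusMeasure_apply _ hD,
    setLIntegral_congr hIoc,
    digitSet_inter_preimage,
    lintegral_image_eq_lintegral_abs_deriv_mul (hD.inter measurableSet_Ico)
      (f' := fun y : ℝ => -1 / ((n : ℝ) + 1 + y) ^ 2) ?_ ?_,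
    setLIntegral_congr hIco,
    ← lintegral_const_mul _ (by fun_prop)]
  · refine setLIntegral_congr_fun (hD.inter measurableSet_Ico) fun y hy => ?_
    have hy0 : 0 ≤ y := hy.2.1
    rw [← ENNReal.ofReal_mul (abs_nonneg _), ← ENNReal.ofReal_mul (digitProb_nonneg hs n)]
    congr 1
    rw [abs_div, abs_neg, abs_one, abs_of_nonneg (by positivity)]
    unfold digitProb digitState
    field_simp
    ring
  · intro y hy
    have hy0 : 0 ≤ y := hy.2.1
    exact (((hasDerivAt_id y).const_add ((n : ℝ) + 1)).inv
      (by simp only [id_eq]; positivity)).hasDerivWithinAt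
  · intro y hy z hz h
    simpa using h

theorem ae_mem_Ioo_mobiusMeasure (s : ℝ) : ∀ᵐ x ∂mobiusMeasure s, x ∈ Set.Ioo (0 : ℝ) 1 :=
  (withDensity_absolutelyContinuous _ _).ae_le (ae_restrict_mem measurableSet_Ioo)

theorem cfDigit_zero_pos {x : ℝ} (hx : x ∈ Set.Ioo (0 : ℝ) 1) : 0 < cfDigit x 0 := by
  simp only [cfDigit, Function.iterate_zero, id_eq, Nat.floor_pos]
  exact (one_le_inv₀ hx.1).2 hx.2.le

theorem mobiusMeasure_preimage {s : ℝ} (hs : 0 ≤ s) {D : Set ℝ} (hD : MeasurableSet D) :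
    mobiusMeasure s (gaussMap ⁻¹' D) =
      ∑' n, ENNReal.ofReal (digitProb s n) * mobiusMeasure (digitState s n) D := by
  simp only [← mobiusMeasure_digitSet_inter hs _ hD]
  rw [← measure_iUnion _ fun n => (measurableSet_digitSet n).inter (measurable_gaussMap hD)]
  · refine measure_congr ?_
    filter_upwards [ae_mem_Ioo_mobiusMeasure s] with x hx
    have h0 := cfDigit_zero_pos hx
    refine propext ⟨fun h => Set.mem_iUnion.2 ⟨cfDigit x 0 - 1, ?_, h⟩, fun h => ?_⟩
    · change cfDigit x 0 = _
      omega
    · obtain ⟨n, hn⟩ := Set.mem_iUnion.1 h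
      exact hn.2
  · intro m n hmn
    refine Set.disjoint_left.2 fun x hx hx' => hmn ?_
    have h1 : cfDigit x 0 = m + 1 := hx.1
    have h2 : cfDigit x 0 = n + 1 := hx'.1
    omega

theorem setLIntegral_Ioo_ofReal_eq_sub {f f' : ℝ → ℝ}
    (hf : ∀ x ∈ Set.Icc (0 : ℝ) 1, HasDerivAt f (f' x) x)
    (hf' : ContinuousOn f' (Set.Icc 0 1)) (h0 : ∀ x ∈ Set.Icc (0 : ℝ) 1, 0 ≤ f' x) :
    ∫⁻ x in Set.Ioo (0 : ℝ) 1, ENNReal.ofReal (f' x) = ENNReal.ofReal (f 1 - f 0) := by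
  rw [← Set.uIcc_of_le zero_le_one] at hf
  have hint : IntervalIntegrable f' volume 0 1 :=
    ContinuousOn.intervalIntegrable (by rwa [Set.uIcc_of_le zero_le_one])
  rw [← intervalIntegral.integral_eq_sub_of_hasDerivAt hf hint,
    intervalIntegral.integral_of_le zero_le_one, setLIntegral_congr Ioo_ae_eq_Ioc,
    ofReal_integral_eq_lintegral_ofReal
      ((intervalIntegrable_iff_integrableOn_Ioc_of_le zero_le_one).1 hint)]
  filter_upwards [ae_restrict_mem measurableSet_Ioc] with x hx
  exact h0 x (Set.Ioc_subset_Icc_self hx)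

theorem isProbabilityMeasure_mobiusMeasure {s : ℝ} (hs : 0 ≤ s) :
    IsProbabilityMeasure (mobiusMeasure s) := by
  constructor
  have hpos : ∀ x ∈ Set.Icc (0 : ℝ) 1, 0 < 1 + s * x := fun x hx => by
    have := mul_nonneg hs hx.1
    linarith
  rw [mobiusMeasure_apply _ MeasurableSet.univ, Set.univ_inter,
    setLIntegral_Ioo_ofReal_eq_sub (f := fun x => (1 + s) * x / (1 + s * x))]
  · simp [div_self (by positivity : 1 + s ≠ 0)]
  · intro x hx
    have := hpos x hx
    refine HasDerivAt.congr_deriv (((hasDerivAt_id' x).const_mul (1 + s)).div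
      (((hasDerivAt_id' x).const_mul s).const_add 1) (by simpa using this.ne')) ?_
    ring
  · exact ContinuousOn.div (by fun_prop) (by fun_prop) fun x hx => by
      have := hpos x hx
      positivity
  · intro x hx
    positivity

theorem mobiusMeasure_lipschitz {D : Set ℝ} (hD : MeasurableSet D) {s t : ℝ}
    (hs : s ∈ Set.Icc (0 : ℝ) 1) (ht : t ∈ Set.Icc (0 : ℝ) 1) :
    |(mobiusMeasure s D).toReal - (mobiusMeasure t D).toReal| ≤ 4 * |s - t| := by
  have hI : ∀ u ∈ Set.Icc (0 : ℝ) 1, IntegrableOn (fun x => (1 + u) / (1 + u * x) ^ 2)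
      (D ∩ Set.Ioo 0 1) ∧ (mobiusMeasure u D).toReal =
        ∫ x in D ∩ Set.Ioo 0 1, (1 + u) / (1 + u * x) ^ 2 := by
    intro u hu
    have hu0 := hu.1
    have hc : IntegrableOn (fun x => (1 + u) / (1 + u * x) ^ 2) (D ∩ Set.Ioo 0 1) := by
      refine IntegrableOn.mono_set (t := Set.Icc 0 1) ?_
        (Set.inter_subset_right.trans Set.Ioo_subset_Icc_self)
      refine ContinuousOn.integrableOn_Icc (ContinuousOn.div (by fun_prop) (by fun_prop) ?_)
      intro x hx
      have := mul_nonneg hu0 hx.1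
      positivity
    refine ⟨hc, ?_⟩
    rw [mobiusMeasure_apply _ hD, ← ofReal_integral_eq_lintegral_ofReal hc,
      ENNReal.toReal_ofReal]
    · exact integral_nonneg fun x => by positivity
    · exact Eventually.of_forall fun x => by positivity
  rw [(hI s hs).2, (hI t ht).2, ← integral_sub (hI s hs).1 (hI t ht).1]
  have hvol : volume (D ∩ Set.Ioo 0 1) ≤ 1 :=
    (measure_mono Set.inter_subset_right).trans (by simp)
  have := norm_setIntegral_le_of_norm_le_const (C := 4 * |s - t|)
    (f := fun x => (1 + s) / (1 + s * x) ^ 2 - (1 + t) / (1 + t * x) ^ 2)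
    (hvol.trans_lt ENNReal.one_lt_top) ?_
  · refine this.trans (mul_le_of_le_one_right (by positivity) ?_)
    exact ENNReal.toReal_le_of_le_ofReal zero_le_one (by simpa using hvol)
  intro x hx
  obtain ⟨hx0, hx1⟩ := hx.2
  obtain ⟨hs0, hs1⟩ := hs
  obtain ⟨ht0, ht1⟩ := ht
  have e1 : 1 ≤ (1 + s * x) ^ 2 := one_le_pow₀ (by nlinarith)
  have e2 : 1 ≤ (1 + t * x) ^ 2 := one_le_pow₀ (by nlinarith)
  have e3 : (1 + s) / (1 + s * x) ^ 2 - (1 + t) / (1 + t * x) ^ 2 =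
      (1 - 2 * x - (s + t) * x ^ 2 - s * t * x ^ 2) * (s - t) /
        ((1 + s * x) ^ 2 * (1 + t * x) ^ 2) := by
    have : (1 + s * x) ≠ 0 := by positivity
    have : (1 + t * x) ≠ 0 := by positivity
    field_simp
    ring
  rw [e3, Real.norm_eq_abs, abs_div, abs_mul, abs_of_nonneg (a := _ ^ 2 * _) (by positivity)]
  refine (div_le_self (by positivity) (one_le_mul_of_one_le_of_one_le e1 e2)).trans ?_
  gcongr
  have hxx : x ^ 2 ≤ 1 := pow_le_one₀ hx0.le hx1.le
  have hst : s * t ≤ 1 := mul_le_one₀ hs1 ht0 ht1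
  have h1 := mul_nonneg (add_nonneg hs0 ht0) (sq_nonneg x)
  have h2 := mul_nonneg (mul_nonneg hs0 ht0) (sq_nonneg x)
  have h3 : (s + t) * x ^ 2 ≤ 2 * 1 := mul_le_mul (by linarith) hxx (sq_nonneg x) (by norm_num)
  have h4 : s * t * x ^ 2 ≤ 1 * 1 := mul_le_mul hst hxx (sq_nonneg x) (by norm_num)
  rw [abs_le]
  constructor <;> linarith

/-- Exponential forgetting: `mobiusMeasure s (T⁻ᵐ D)` hardly depends on `s` for large `m`. -/
theorem mobiusMeasure_iterate_lipschitz {D : Set ℝ} (hD : MeasurableSet D) (m : ℕ) :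
    ∀ s ∈ Set.Icc (0 : ℝ) 1, ∀ t ∈ Set.Icc (0 : ℝ) 1,
      |(mobiusMeasure s (gaussMap^[m] ⁻¹' D)).toReal -
        (mobiusMeasure t (gaussMap^[m] ⁻¹' D)).toReal| ≤ (11 / 12) ^ m * 4 * |s - t| := by
  induction m with
  | zero =>
    intro s hs t ht
    simpa using mobiusMeasure_lipschitz hD hs ht
  | succ m ih =>
    have hDm : MeasurableSet (gaussMap^[m] ⁻¹' D) := measurable_gaussMap.iterate m hD
    have := lipschitz_contraction (by positivity) ih
      (G := fun s => (mobiusMeasure s (gaussMap^[m + 1] ⁻¹' D)).toReal) ?_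
    · simpa only [pow_succ', mul_assoc] using this
    intro s hs
    have := isProbabilityMeasure_mobiusMeasure hs.1
    have hpre := mobiusMeasure_preimage hs.1 hDm
    rw [← Set.preimage_comp, ← Function.iterate_succ] at hpre
    have hne : ∑' n, ENNReal.ofReal (digitProb s n) *
        mobiusMeasure (digitState s n) (gaussMap^[m] ⁻¹' D) ≠ ⊤ := hpre ▸ measure_ne_top _ _
    have hsum := ENNReal.hasSum_toReal hne
    rw [← ENNReal.tsum_toReal_eq (ENNReal.ne_top_of_tsum_ne_top hne), ← hpre] at hsum
    simpa [ENNReal.toReal_mul, ENNReal.toReal_ofReal (digitProb_nonneg hs.1 _)] using hsum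

theorem gaussMeasure_eq_lintegral {D : Set ℝ} (hD : MeasurableSet D) :
    gaussMeasure D = ∫⁻ s, mobiusMeasure s D ∂gaussMeasure := by
  have hm : Measurable fun s => mobiusMeasure s D := by
    simp only [mobiusMeasure_apply _ hD]
    exact Measurable.lintegral_prod_right (by fun_prop)
  have hl : 0 < Real.log 2 := Real.log_pos one_lt_two
  rw [gaussMeasure, lintegral_withDensity_eq_lintegral_mul _ (by fun_prop) hm,
    withDensity_apply _ hD, Measure.restrict_restrict hD]
  simp only [Pi.mul_apply, mobiusMeasure_apply _ hD]
  simp_rw [← lintegral_const_mul' _ _ ENNReal.ofReal_ne_top]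
  rw [lintegral_lintegral_swap (by fun_prop)]
  refine setLIntegral_congr_fun (hD.inter measurableSet_Ioo) fun x hx => ?_
  have hx0 : 0 < x := hx.2.1
  have h1 : ∀ s ∈ Set.Ioo (0 : ℝ) 1, ENNReal.ofReal (1 / ((1 + s) * Real.log 2)) *
      ENNReal.ofReal ((1 + s) / (1 + s * x) ^ 2) =
      ENNReal.ofReal (1 / Real.log 2 / (1 + s * x) ^ 2) := by
    intro s hs
    have hs0 : 0 < s := hs.1
    rw [← ENNReal.ofReal_mul (by positivity)]
    congr 1
    field_simp
  have hpos : ∀ s ∈ Set.Icc (0 : ℝ) 1, 0 < 1 + s * x := fun s hs => by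
    have := mul_nonneg hs.1 hx0.le
    linarith
  rw [setLIntegral_congr_fun measurableSet_Ioo h1, setLIntegral_Ioo_ofReal_eq_sub
    (f := fun s => (1 / Real.log 2) * s / (1 + s * x))]
  · congr 1
    field_simp
    simp
  · intro s hs
    have := hpos s hs
    refine HasDerivAt.congr_deriv (((hasDerivAt_id' s).const_mul (1 / Real.log 2)).div
      (((hasDerivAt_id' s).mul_const x).const_add 1) (by simpa using this.ne')) ?_
    ring
  · exact ContinuousOn.div (by fun_prop) (by fun_prop) fun s hs => by
      have := hpos s hs
      positivity
  · intro s hs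
    positivity

theorem isProbabilityMeasure_gaussMeasure : IsProbabilityMeasure gaussMeasure := by
  constructor
  have hl : 0 < Real.log 2 := Real.log_pos one_lt_two
  rw [gaussMeasure, withDensity_apply _ MeasurableSet.univ, Measure.restrict_univ,
    setLIntegral_Ioo_ofReal_eq_sub (f := fun x => Real.log (1 + x) / Real.log 2)]
  · norm_num
  · intro x hx
    have : 1 + x ≠ 0 := by linarith [hx.1]
    refine HasDerivAt.congr_deriv
      ((((hasDerivAt_id' x).const_add 1).log this).div_const (Real.log 2)) ?_
    field_simp
  · exact ContinuousOn.div (by fun_prop) (by fun_prop) fun x hx =>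
      mul_ne_zero (by linarith [hx.1]) hl.ne'
  · intro x hx
    have := hx.1
    positivity

theorem ae_mem_Ioo_gaussMeasure : ∀ᵐ x ∂gaussMeasure, x ∈ Set.Ioo (0 : ℝ) 1 :=
  (withDensity_absolutelyContinuous _ _).ae_le (ae_restrict_mem measurableSet_Ioo)

theorem abs_sum_range_add_sub_le {f : ℕ → ℝ} (hf : ∀ i, |f i| ≤ 1) (e N : ℕ) :
    |∑ i ∈ Finset.range N, f (i + e) - ∑ i ∈ Finset.range N, f i| ≤ 2 * e := by
  have h1 := Finset.sum_range_add f e N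
  have h2 := Finset.sum_range_add f N e
  rw [add_comm N e] at h2
  have hb : ∀ g : ℕ → ℕ, |∑ i ∈ Finset.range e, f (g i)| ≤ e := fun g =>
    (Finset.abs_sum_le_sum_abs _ _).trans ((Finset.sum_le_sum fun i _ => hf (g i)).trans (by simp))
  have h3 := abs_le.1 (hb fun i => i)
  have h4 := abs_le.1 (hb fun i => N + i)
  have h5 : ∑ i ∈ Finset.range N, f (e + i) = ∑ i ∈ Finset.range N, f (i + e) := by
    simp only [add_comm]
  rw [abs_le]
  constructor <;> linarith

theorem tendsto_average_add_sub {f : ℕ → ℝ} (hf : ∀ i, |f i| ≤ 1) (e : ℕ) :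
    Tendsto (fun N : ℕ => (∑ i ∈ Finset.range N, f (i + e)) / N -
      (∑ i ∈ Finset.range N, f i) / N) atTop (nhds 0) := by
  refine squeeze_zero_norm (fun N => ?_) (tendsto_const_div_atTop_nhds_zero_nat (2 * (e : ℝ)))
  rw [← sub_div, Real.norm_eq_abs, abs_div, Nat.abs_cast]
  gcongr
  exact abs_sum_range_add_sub_le hf e N

theorem tendsto_average_add {f : ℕ → ℝ} (hf : ∀ i, |f i| ≤ 1) {l : ℝ}
    (h : Tendsto (fun N : ℕ => (∑ i ∈ Finset.range N, f i) / N) atTop (nhds l)) (e : ℕ) :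
    Tendsto (fun N : ℕ => (∑ i ∈ Finset.range N, f (i + e)) / N) atTop (nhds l) := by
  simpa using (tendsto_average_add_sub hf e).add h

/-- A van der Corput type criterion: if the autocorrelations of a bounded sequence along multiples
of `k` exist and tend to zero, then its averages along every progression modulo `k` vanish. -/
theorem tendsto_average_progression {a : ℕ → ℝ} (ha : ∀ i, |a i| ≤ 1) {k r : ℕ} (hr : r < k)
    {ρ : ℕ → ℝ}
    (hρ : ∀ d, Tendsto (fun N : ℕ => (∑ i ∈ Finset.range N, a i * a (i + k * d)) / N) atTop
      (nhds (ρ d)))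
    (h0 : Tendsto ρ atTop (nhds 0)) :
    Tendsto (fun N : ℕ => (∑ i ∈ Finset.range N, a (k * i + r)) / N) atTop (nhds 0) := by
  have haa : ∀ i j, |a i * a j| ≤ 1 := fun i j => by
    rw [abs_mul]; exact mul_le_one₀ (ha i) (abs_nonneg _) (ha j)
  have hk : (0 : ℝ) < k := by exact_mod_cast (Nat.zero_le r).trans_lt hr
  have hpair : ∀ d e, Tendsto (fun N : ℕ => (∑ j ∈ Finset.range N,
      a (j + k * d) * a (j + k * e)) / N) atTop (nhds (ρ ((d - e) + (e - d)))) := by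
    intro d e
    rcases le_total d e with h | h
    · have := tendsto_average_add (f := fun i => a i * a (i + k * (e - d)))
        (fun i => haa _ _) (hρ (e - d)) (k * d)
      have e1 : ∀ j, j + k * e = j + k * d + k * (e - d) := fun j => by
        rw [add_assoc, ← Nat.mul_add, Nat.add_sub_cancel' h]
      simpa only [e1, Nat.sub_eq_zero_of_le h, zero_add] using this
    · have := tendsto_average_add (f := fun i => a i * a (i + k * (d - e)))
        (fun i => haa _ _) (hρ (d - e)) (k * e)
      have e1 : ∀ j, j + k * d = j + k * e + k * (d - e) := fun j => by
        rw [add_assoc, ← Nat.mul_add, Nat.add_sub_cancel' h]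
      simpa only [e1, Nat.sub_eq_zero_of_le h, add_zero, mul_comm (a (_ + k * e))] using this
  have hρ1 : ρ 0 ≤ 1 := by
    refine le_of_tendsto (hρ 0) (Eventually.of_forall fun N => ?_)
    refine div_le_one_of_le₀ ?_ N.cast_nonneg
    exact (Finset.sum_le_sum fun i _ => (le_abs_self _).trans (haa _ _)).trans (by simp)
  rw [Metric.tendsto_atTop']
  intro ε hε
  set δ : ℝ := ε ^ 2 / (12 * k) with hδ
  have hδ0 : 0 < δ := by positivity
  obtain ⟨D, hD1, hD⟩ : ∃ D : ℕ, 1 ≤ D ∧ ∀ d ≥ D, ρ d ≤ δ := by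
    obtain ⟨D, hD⟩ := eventually_atTop.1 (h0.eventually (eventually_le_nhds hδ0))
    exact ⟨max D 1, le_max_right _ _, fun d hd => hD d ((le_max_left _ _).trans hd)⟩
  obtain ⟨M, hM⟩ := exists_nat_gt (1 / δ)
  have hM0 : (0 : ℝ) < M := (by positivity : (0 : ℝ) < 1 / δ).trans hM
  have hMδ : 1 < M * δ := by rwa [div_lt_iff₀ hδ0] at hM
  set g : ℕ → ℝ := fun j => ∑ m ∈ Finset.range M, a (j + k * (D * m)) with hg
  set Q : ℝ := ∑ m ∈ Finset.range M, ∑ m' ∈ Finset.range M,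
    ρ ((D * m - D * m') + (D * m' - D * m)) with hQ
  have hQlim : Tendsto (fun N : ℕ => (∑ j ∈ Finset.range N, g j ^ 2) / N) atTop (nhds Q) := by
    have := tendsto_finsetSum (Finset.range M) fun m _ =>
      tendsto_finsetSum (Finset.range M) fun m' _ => hpair (D * m) (D * m')
    refine this.congr fun N => ?_
    simp only [hg, sq, Finset.sum_mul_sum, ← Finset.sum_div]
    congr 1
    rw [Finset.sum_comm]
    conv_rhs => rw [Finset.sum_comm]
    rw [Finset.sum_comm]
    refine Finset.sum_congr rfl fun m _ => ?_
    rw [Finset.sum_comm]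
  have hQle : Q < 3 * δ * M ^ 2 := by
    have : Q ≤ ∑ m ∈ Finset.range M, ∑ m' ∈ Finset.range M,
        ((if m = m' then 1 else 0) + δ) := by
      refine Finset.sum_le_sum fun m _ => Finset.sum_le_sum fun m' _ => ?_
      rcases eq_or_ne m m' with rfl | h
      · simpa using hρ1.trans (by linarith)
      · rw [if_neg h, zero_add]
        apply hD
        rcases lt_or_gt_of_ne h with h | h
        · have : D * (m + 1) ≤ D * m' := Nat.mul_le_mul_left _ h
          rw [Nat.mul_succ] at this; omega
        · have : D * (m' + 1) ≤ D * m := Nat.mul_le_mul_left _ h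
          rw [Nat.mul_succ] at this; omega
    have h2 : ∑ m ∈ Finset.range M, ∑ m' ∈ Finset.range M,
        ((if m = m' then (1 : ℝ) else 0) + δ) = M + M ^ 2 * δ := by
      have : ∀ m ∈ Finset.range M, ∑ m' ∈ Finset.range M,
          ((if m = m' then (1 : ℝ) else 0) + δ) = 1 + M * δ := by
        intro m hm
        rw [Finset.sum_add_distrib, Finset.sum_ite_eq, if_pos hm]; simp
      rw [Finset.sum_congr rfl this]; simp; ring
    nlinarith
  have hkN : Tendsto (fun N : ℕ => k * N) atTop atTop :=
    tendsto_id.const_mul_atTop' (by exact_mod_cast hk)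
  have hev := (hQlim.comp hkN).eventually (eventually_lt_nhds hQle)
  have hdiff : Tendsto (fun N : ℕ => ∑ m ∈ Finset.range M,
      ((∑ i ∈ Finset.range N, a (k * (i + D * m) + r)) / N -
        (∑ i ∈ Finset.range N, a (k * i + r)) / N)) atTop (nhds 0) := by
    simpa using tendsto_finsetSum (Finset.range M) fun m _ =>
      tendsto_average_add_sub (f := fun i => a (k * i + r)) (fun i => ha _) (D * m)
  have hev2 := hdiff.eventually (Metric.ball_mem_nhds 0 (show 0 < M * (ε / 2) by positivity))
  obtain ⟨n₀, hn₀⟩ := eventually_atTop.1 (hev.and hev2)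
  refine ⟨n₀, fun N hN => ?_⟩
  obtain ⟨h1, h2⟩ := hn₀ N hN.le
  have hN0 : (0 : ℝ) < N := by exact_mod_cast (Nat.zero_le _).trans_lt hN
  set b : ℝ := (∑ i ∈ Finset.range N, a (k * i + r)) / N with hb
  set c : ℝ := ∑ i ∈ Finset.range N, g (k * i + r) with hc
  have hcsum : ∑ m ∈ Finset.range M,
      ((∑ i ∈ Finset.range N, a (k * (i + D * m) + r)) / N - b) = c / N - M * b := by
    rw [Finset.sum_sub_distrib, ← Finset.sum_div, Finset.sum_comm]
    simp only [Finset.sum_const, Finset.card_range, nsmul_eq_mul, hc, hg]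
    congr 2
    refine Finset.sum_congr rfl fun i _ => Finset.sum_congr rfl fun m _ => ?_
    congr 1; ring
  have hc2 : c ^ 2 ≤ N * ∑ j ∈ Finset.range (k * N), g j ^ 2 := by
    refine sq_sum_le_card_mul_sum_sq.trans ?_
    rw [Finset.card_range]
    gcongr
    rw [← Finset.sum_image (f := fun j => g j ^ 2) (g := fun i => k * i + r)]
    · refine Finset.sum_le_sum_of_subset_of_nonneg ?_ fun _ _ _ => sq_nonneg _
      intro j hj
      obtain ⟨i, hi, rfl⟩ := Finset.mem_image.1 hj
      rw [Finset.mem_range] at hi ⊢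
      have : k * (i + 1) ≤ k * N := Nat.mul_le_mul_left _ hi
      rw [Nat.mul_succ] at this; omega
    · intro i _ j _ hij
      have : k * i = k * j := by simpa using hij
      exact Nat.eq_of_mul_eq_mul_left ((Nat.zero_le r).trans_lt hr) this
  simp only [Function.comp_apply, Nat.cast_mul] at h1
  rw [div_lt_iff₀ (by positivity)] at h1
  have hcN : (c / N) ^ 2 ≤ (M * (ε / 2)) ^ 2 := by
    rw [div_pow, div_le_iff₀ (by positivity)]
    have : 3 * δ * M ^ 2 * (k * N) = (M * (ε / 2)) ^ 2 * N := by
      rw [hδ]; field_simp; ring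
    nlinarith
  have hcN' := abs_le_of_sq_le_sq hcN (by positivity)
  rw [hcsum, dist_zero_right, Real.norm_eq_abs] at h2
  rw [dist_zero_right, Real.norm_eq_abs]
  have : M * |b| < M * ε := by
    have e1 : (M : ℝ) * |b| = |c / N - (c / N - M * b)| := by
      rw [sub_sub_cancel, abs_mul, Nat.abs_cast]
    have := abs_sub (c / N) (c / N - M * b)
    have h3 : |c / N| ≤ M * (ε / 2) := hcN'
    rw [e1]; linarith
  exact lt_of_mul_lt_mul_left this hM0.le

/-- Indicator that the Gauss orbit of `x` is in `D` at time `i`. -/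
noncomputable def visit (x : ℝ) (D : Set ℝ) (i : ℕ) : ℝ :=
  D.indicator (fun _ => (1 : ℝ)) (gaussMap^[i] x)

theorem visit_nonneg (x : ℝ) (D : Set ℝ) (i : ℕ) : 0 ≤ visit x D i :=
  Set.indicator_nonneg (fun _ _ => zero_le_one) _

theorem visit_le_one (x : ℝ) (D : Set ℝ) (i : ℕ) : visit x D i ≤ 1 :=
  Set.indicator_le_self' (fun _ _ => zero_le_one) _

theorem abs_visit_le (x : ℝ) (D : Set ℝ) (i : ℕ) : |visit x D i| ≤ 1 := by
  rw [abs_of_nonneg (visit_nonneg x D i)]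
  exact visit_le_one x D i

theorem natCard_eq_sum_indicator (p : ℕ → Prop) (N : ℕ) :
    (Nat.card {i : ℕ // i < N ∧ p i} : ℝ) =
      ∑ i ∈ Finset.range N, {i | p i}.indicator (fun _ => (1 : ℝ)) i := by
  classical
  have h : Nat.card {i : ℕ // i < N ∧ p i} = ((Finset.range N).filter p).card :=
    Nat.subtype_card _ (by simp)
  rw [h, Finset.card_filter, Nat.cast_sum]
  simp [Set.indicator_apply]

/-- Membership in `D` is determined by the first `n` digits. -/
def DigitDetermined (n : ℕ) (D : Set ℝ) : Prop :=
  ∀ y ∈ Set.Ioo (0 : ℝ) 1, ∀ z ∈ Set.Ioo (0 : ℝ) 1,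
    (∀ i < n, cfDigit y i = cfDigit z i) → y ∈ D → z ∈ D

theorem DigitDetermined.compl {n : ℕ} {D : Set ℝ} (h : DigitDetermined n D) :
    DigitDetermined n Dᶜ :=
  fun y hy z hz hyz hyD hzD => hyD (h z hz y hy (fun i hi => (hyz i hi).symm) hzD)

theorem measurableSet_cylinder (w : List ℕ) : MeasurableSet (cylinder w) := by
  have : cylinder w = Set.Ioo 0 1 ∩ ⋂ i, ⋂ (_ : i < w.length),
      (fun x => cfDigit x i) ⁻¹' {w.getD i 0} := by
    ext; simp [_root_.cylinder]
  rw [this]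
  exact measurableSet_Ioo.inter (MeasurableSet.iInter fun i => MeasurableSet.iInter fun _ =>
    measurable_cfDigit i (measurableSet_singleton _))

theorem irrational_iterate_gaussMap {x : ℝ} (hx : x ∈ Set.Ioo (0 : ℝ) 1) (h : Irrational x)
    (i : ℕ) : gaussMap^[i] x ∈ Set.Ioo (0 : ℝ) 1 ∧ Irrational (gaussMap^[i] x) := by
  induction i with
  | zero => exact ⟨hx, h⟩
  | succ i ih =>
    rw [Function.iterate_succ_apply']
    have hirr : Irrational (gaussMap (gaussMap^[i] x)) := ih.2.inv.sub_intCast _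
    exact ⟨⟨(Int.fract_nonneg _).lt_of_ne' hirr.ne_zero, Int.fract_lt_one _⟩, hirr⟩

theorem ae_irrational_gaussMeasure : ∀ᵐ x ∂gaussMeasure, Irrational x := by
  have h : gaussMeasure ≪ volume :=
    (withDensity_absolutelyContinuous _ _).trans Measure.absolutelyContinuous_restrict
  exact h.ae_le ((Set.countable_range ((↑) : ℚ → ℝ)).ae_notMem volume)

theorem mem_cylinder_map_cfDigit {y : ℝ} (hy : y ∈ Set.Ioo (0 : ℝ) 1) (n : ℕ) :
    y ∈ cylinder ((List.range n).map (cfDigit y)) := by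
  refine ⟨hy, fun i hi => ?_⟩
  rw [List.getD_eq_getElem _ _ hi]
  simp

theorem eq_of_mem_cylinder {y : ℝ} {v w : List ℕ} (hv : y ∈ cylinder v) (hw : y ∈ cylinder w)
    (h : v.length = w.length) : v = w := by
  refine List.ext_getElem h fun i h1 h2 => ?_
  have e1 := hv.2 i h1
  have e2 := hw.2 i h2
  rw [List.getD_eq_getElem _ _ h1] at e1
  rw [List.getD_eq_getElem _ _ h2] at e2
  rw [← e1, e2]

theorem tendsto_average_visit_cylinder {x : ℝ} (hnorm : CFNormal x) {w : List ℕ} (hw : w ≠ [])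
    (hpos : ∀ a ∈ w, 0 < a) :
    Tendsto (fun N : ℕ => (∑ i ∈ Finset.range N, visit x (cylinder w) i) / N) atTop
      (nhds (gaussMeasure (cylinder w)).toReal) := by
  have h1 : Tendsto (fun N : ℕ => visit x (cylinder w) N / N) atTop (nhds 0) := by
    refine squeeze_zero_norm (fun N => ?_) (tendsto_const_div_atTop_nhds_zero_nat (1 : ℝ))
    rw [Real.norm_eq_abs, abs_div, Nat.abs_cast]
    gcongr
    exact abs_visit_le _ _ _
  have h2 := (hnorm w hw hpos).sub h1
  rw [sub_zero] at h2
  refine h2.congr fun N => ?_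
  have h3 : (blockCount x 1 w N : ℝ) = ∑ i ∈ Finset.range (N + 1), visit x (cylinder w) i := by
    have := natCard_eq_sum_indicator (fun i => gaussMap^[i] x ∈ cylinder w) (N + 1)
    simp only [Nat.lt_succ_iff] at this
    simp only [blockCount, one_mul]
    exact this
  rw [h3, Finset.sum_range_succ, add_div, add_sub_cancel_right]

theorem eventually_lt_average_visit {x : ℝ} (hnorm : CFNormal x) {n : ℕ} (hn : n ≠ 0)
    {D : Set ℝ} (hdet : DigitDetermined n D) {c : ℝ} (hc : c < (gaussMeasure D).toReal) :
    ∀ᶠ N : ℕ in atTop, c < (∑ i ∈ Finset.range N, visit x D i) / N := by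
  have := isProbabilityMeasure_gaussMeasure
  let ι := {w : List ℕ // w.length = n ∧ (∀ a ∈ w, 0 < a) ∧ cylinder w ⊆ D}
  have hdisj : Pairwise (Function.onFun Disjoint fun w : ι => cylinder w.1) := by
    intro v w hvw
    refine Set.disjoint_left.2 fun y hv hw => hvw (Subtype.ext ?_)
    exact eq_of_mem_cylinder hv hw (v.2.1.trans w.2.1.symm)
  have hD : gaussMeasure D = ∑' w : ι, gaussMeasure (cylinder w.1) := by
    rw [← measure_iUnion hdisj fun w => measurableSet_cylinder _]
    refine measure_congr ?_
    filter_upwards [ae_mem_Ioo_gaussMeasure, ae_irrational_gaussMeasure] with y hy hirr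
    refine propext ⟨fun h => Set.mem_iUnion.2
      ⟨⟨(List.range n).map (cfDigit y), by simp, ?_, ?_⟩, mem_cylinder_map_cfDigit hy n⟩,
      fun h => ?_⟩
    · intro a ha
      obtain ⟨i, -, rfl⟩ := List.mem_map.1 ha
      exact cfDigit_zero_pos (irrational_iterate_gaussMap hy hirr i).1
    · intro z hz
      refine hdet y hy z hz.1 (fun i hi => ?_) h
      have hi' : i < ((List.range n).map (cfDigit y)).length := by simpa using hi
      rw [hz.2 i hi', List.getD_eq_getElem _ _ hi']
      simp
    · obtain ⟨w, hw⟩ := Set.mem_iUnion.1 h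
      exact w.2.2.2 hw
  have hsum : HasSum (fun w : ι => (gaussMeasure (cylinder w.1)).toReal)
      (gaussMeasure D).toReal := by
    rw [hD, ENNReal.tsum_toReal_eq fun w => measure_ne_top _ _]
    exact ENNReal.hasSum_toReal (hD ▸ measure_ne_top _ _)
  obtain ⟨W, hW⟩ := (hsum.eventually (eventually_gt_nhds hc)).exists
  have hlim : Tendsto (fun N : ℕ => ∑ w ∈ W,
      (∑ i ∈ Finset.range N, visit x (cylinder w.1) i) / N) atTop
      (nhds (∑ w ∈ W, (gaussMeasure (cylinder w.1)).toReal)) :=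
    tendsto_finsetSum W fun w _ => tendsto_average_visit_cylinder hnorm
      (fun h => hn (by rw [← w.2.1, h, List.length_nil])) w.2.2.1
  filter_upwards [hlim.eventually (eventually_gt_nhds hW)] with N hN
  refine hN.trans_le ?_
  rw [← Finset.sum_div, Finset.sum_comm]
  gcongr with i
  by_cases h : ∃ w ∈ W, gaussMap^[i] x ∈ cylinder w.1
  · obtain ⟨w, hw, hwi⟩ := h
    rw [Finset.sum_eq_single_of_mem w hw]
    · exact Set.indicator_le_indicator_of_subset w.2.2.2 (fun _ => zero_le_one) _
    · intro v _ hv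
      exact Set.indicator_of_notMem
        (fun hvi => Set.disjoint_left.1 (hdisj hv) hvi hwi) _
  · push Not at h
    rw [show ∑ w ∈ W, visit x (cylinder w.1) i = 0 from
      Finset.sum_eq_zero fun w hw => Set.indicator_of_notMem (h w hw) _]
    exact visit_nonneg _ _ _

theorem tendsto_average_visit {x : ℝ} (hnorm : CFNormal x) {n : ℕ} (hn : n ≠ 0) {D : Set ℝ}
    (hD : MeasurableSet D) (hdet : DigitDetermined n D) :
    Tendsto (fun N : ℕ => (∑ i ∈ Finset.range N, visit x D i) / N) atTop
      (nhds (gaussMeasure D).toReal) := by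
  have := isProbabilityMeasure_gaussMeasure
  refine tendsto_order.2 ⟨fun c hc => eventually_lt_average_visit hnorm hn hdet hc, fun c hc => ?_⟩
  have hcompl : (gaussMeasure Dᶜ).toReal = 1 - (gaussMeasure D).toReal :=
    probReal_compl_eq_one_sub hD
  filter_upwards [eventually_lt_average_visit hnorm hn hdet.compl (c := 1 - c) (by linarith),
    eventually_gt_atTop 0] with N hN hN0
  have hadd : (∑ i ∈ Finset.range N, visit x D i) / N +
      (∑ i ∈ Finset.range N, visit x Dᶜ i) / N = 1 := by
    have h1 : ∀ i, visit x D i + visit x Dᶜ i = 1 := fun i =>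
      congrFun (Set.indicator_self_add_compl D fun _ => (1 : ℝ)) _
    rw [← add_div, ← Finset.sum_add_distrib]
    simp only [h1]
    simp [hN0.ne']
  linarith

theorem mem_cylinder_one_iff {x : ℝ} (hx : x ∈ Set.Ioo (0 : ℝ) 1) (i : ℕ) :
    gaussMap^[i] x ∈ cylinder [1] ↔ cfDigit x i = 1 := by
  have h0 : 0 ≤ gaussMap^[i] x ∧ gaussMap^[i] x < 1 := by
    cases i with
    | zero => exact ⟨hx.1.le, hx.2⟩
    | succ i =>
      rw [Function.iterate_succ_apply']
      exact ⟨Int.fract_nonneg _, Int.fract_lt_one _⟩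
  constructor
  · intro h
    exact h.2 0 (by simp)
  · intro h
    refine ⟨⟨h0.1.lt_of_ne fun h1 => ?_, h0.2⟩, fun j hj => ?_⟩
    · rw [cfDigit, ← h1] at h
      simp at h
    · obtain rfl : j = 0 := by simpa using hj
      exact h

/-- Numbers whose expansion has digit `1` at the positions `0` and `k`. -/
def gapPair (k : ℕ) : Set ℝ := cylinder [1] ∩ gaussMap^[k] ⁻¹' cylinder [1]

theorem measurableSet_gapPair (k : ℕ) : MeasurableSet (gapPair k) :=
  (measurableSet_cylinder _).inter (measurable_gaussMap.iterate k (measurableSet_cylinder _))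

theorem iterate_mem_gapPair_iff {x : ℝ} (hx : x ∈ Set.Ioo (0 : ℝ) 1) (k i : ℕ) :
    gaussMap^[i] x ∈ gapPair k ↔ cfDigit x i = 1 ∧ cfDigit x (k + i) = 1 := by
  rw [← mem_cylinder_one_iff hx, ← mem_cylinder_one_iff hx, Function.iterate_add_apply]
  rfl

theorem digitDetermined_preimage_gapPair (k d : ℕ) :
    DigitDetermined (k + d + 1) (gaussMap^[d] ⁻¹' gapPair k) := by
  intro y hy z hz h hyD
  rw [Set.mem_preimage, iterate_mem_gapPair_iff hy] at hyD
  rw [Set.mem_preimage, iterate_mem_gapPair_iff hz, ← h d (by omega), ← h (k + d) (by omega)]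
  exact hyD

theorem DigitDetermined.mono {m n : ℕ} {D : Set ℝ} (h : DigitDetermined m D) (hmn : m ≤ n) :
    DigitDetermined n D :=
  fun y hy z hz hyz => h y hy z hz fun i hi => hyz i (hi.trans_le hmn)

theorem DigitDetermined.inter {n : ℕ} {D E : Set ℝ} (hD : DigitDetermined n D)
    (hE : DigitDetermined n E) : DigitDetermined n (D ∩ E) :=
  fun y hy z hz hyz h => ⟨hD y hy z hz hyz h.1, hE y hy z hz hyz h.2⟩

theorem visit_add (x : ℝ) (D : Set ℝ) (i d : ℕ) :
    visit x D (i + d) = visit x (gaussMap^[d] ⁻¹' D) i := by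
  rw [visit, add_comm, Function.iterate_add_apply]
  rfl

theorem gaussMeasure_preimage_gapPair {x : ℝ} (hnorm : CFNormal x) (k d : ℕ) :
    (gaussMeasure (gaussMap^[d] ⁻¹' gapPair k)).toReal = (gaussMeasure (gapPair k)).toReal := by
  have h1 := tendsto_average_visit hnorm (Nat.succ_ne_zero _)
    (measurable_gaussMap.iterate d (measurableSet_gapPair k)) (digitDetermined_preimage_gapPair k d)
  have h2 := tendsto_average_add (abs_visit_le x (gapPair k)) (tendsto_average_visit hnorm
    (Nat.succ_ne_zero _) (measurableSet_gapPair k) (digitDetermined_preimage_gapPair k 0)) d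
  simp only [visit_add] at h2
  exact tendsto_nhds_unique h1 h2

theorem mobiusMeasure_digitSet_mono {c₁ c₂ : ENNReal} {D E : Set ℝ} (hD : MeasurableSet D)
    (hE : MeasurableSet E)
    (h : ∀ s ∈ Set.Icc (0 : ℝ) 1, c₁ * mobiusMeasure s D ≤ c₂ * mobiusMeasure s E) (n : ℕ) :
    ∀ s ∈ Set.Icc (0 : ℝ) 1, c₁ * mobiusMeasure s (digitSet n ∩ gaussMap ⁻¹' D) ≤
      c₂ * mobiusMeasure s (digitSet n ∩ gaussMap ⁻¹' E) := by
  intro s hs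
  rw [mobiusMeasure_digitSet_inter hs.1 n hD, mobiusMeasure_digitSet_inter hs.1 n hE,
    mul_left_comm, mul_left_comm c₂]
  exact mul_le_mul' le_rfl (h _ (digitState_mem hs.1 n))

theorem mobiusMeasure_preimage_mono {c₁ c₂ : ENNReal} {D E : Set ℝ} (hD : MeasurableSet D)
    (hE : MeasurableSet E)
    (h : ∀ s ∈ Set.Icc (0 : ℝ) 1, c₁ * mobiusMeasure s D ≤ c₂ * mobiusMeasure s E) (n : ℕ) :
    ∀ s ∈ Set.Icc (0 : ℝ) 1, c₁ * mobiusMeasure s (gaussMap^[n] ⁻¹' D) ≤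
      c₂ * mobiusMeasure s (gaussMap^[n] ⁻¹' E) := by
  induction n with
  | zero => exact h
  | succ n ih =>
    intro s hs
    rw [Function.iterate_succ, Set.preimage_comp, Set.preimage_comp,
      mobiusMeasure_preimage hs.1 (measurable_gaussMap.iterate n hD),
      mobiusMeasure_preimage hs.1 (measurable_gaussMap.iterate n hE),
      ← ENNReal.tsum_mul_left, ← ENNReal.tsum_mul_left]
    refine ENNReal.tsum_le_tsum fun i => ?_
    rw [mul_left_comm, mul_left_comm c₂]
    exact mul_le_mul' le_rfl (ih _ (digitState_mem hs.1 i))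

theorem gaussMeasure_mono_of_mobiusMeasure {c₁ c₂ : ENNReal} (hc₁ : c₁ ≠ ⊤) (hc₂ : c₂ ≠ ⊤)
    {D E : Set ℝ} (hD : MeasurableSet D) (hE : MeasurableSet E)
    (h : ∀ s ∈ Set.Icc (0 : ℝ) 1, c₁ * mobiusMeasure s D ≤ c₂ * mobiusMeasure s E) :
    c₁ * gaussMeasure D ≤ c₂ * gaussMeasure E := by
  rw [gaussMeasure_eq_lintegral hD, gaussMeasure_eq_lintegral hE,
    ← lintegral_const_mul' _ _ hc₁, ← lintegral_const_mul' _ _ hc₂]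
  refine lintegral_mono_ae ?_
  filter_upwards [ae_mem_Ioo_gaussMeasure] with s hs
  exact h s (Set.Ioo_subset_Icc_self hs)

theorem abs_mobiusMeasure_iterate_sub_le {D : Set ℝ} (hD : MeasurableSet D) (m : ℕ) {s : ℝ}
    (hs : s ∈ Set.Icc (0 : ℝ) 1) :
    |(mobiusMeasure s (gaussMap^[m] ⁻¹' D)).toReal -
      (gaussMeasure (gaussMap^[m] ⁻¹' D)).toReal| ≤ (11 / 12) ^ m * 4 := by
  have := isProbabilityMeasure_gaussMeasure
  have hDm : MeasurableSet (gaussMap^[m] ⁻¹' D) := measurable_gaussMap.iterate m hD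
  have hγ := gaussMeasure_eq_lintegral hDm
  set q := (mobiusMeasure s (gaussMap^[m] ⁻¹' D)).toReal
  set ε : ℝ := (11 / 12) ^ m * 4
  have hε : 0 ≤ ε := by positivity
  have hq : 0 ≤ q := ENNReal.toReal_nonneg
  have hclose : ∀ᵐ t ∂gaussMeasure,
      ENNReal.ofReal (q - ε) ≤ mobiusMeasure t (gaussMap^[m] ⁻¹' D) ∧
        mobiusMeasure t (gaussMap^[m] ⁻¹' D) ≤ ENNReal.ofReal (q + ε) := by
    filter_upwards [ae_mem_Ioo_gaussMeasure] with t ht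
    have := isProbabilityMeasure_mobiusMeasure ht.1.le
    have h1 := (mobiusMeasure_iterate_lipschitz hD m s hs t (Set.Ioo_subset_Icc_self ht)).trans
      (mul_le_of_le_one_right hε (by
        rw [abs_le]; constructor <;> linarith [hs.1, hs.2, ht.1, ht.2]))
    rw [abs_le] at h1
    constructor
    · exact ENNReal.ofReal_le_of_le_toReal (by linarith)
    · exact (ENNReal.le_ofReal_iff_toReal_le (measure_ne_top _ _) (by positivity)).2 (by linarith)
  have h1 : gaussMeasure (gaussMap^[m] ⁻¹' D) ≤ ENNReal.ofReal (q + ε) := by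
    rw [hγ]
    simpa using lintegral_mono_ae (hclose.mono fun t h => h.2)
  have h2 : ENNReal.ofReal (q - ε) ≤ gaussMeasure (gaussMap^[m] ⁻¹' D) := by
    rw [hγ]
    simpa using lintegral_mono_ae (hclose.mono fun t h => h.1)
  have h3 := (ENNReal.le_ofReal_iff_toReal_le (measure_ne_top _ _) (by positivity)).1 h1
  have h4 := (ENNReal.ofReal_le_iff_le_toReal (measure_ne_top _ _)).1 h2
  rw [abs_le]
  constructor <;> linarith

theorem mem_digitSet_zero_inter_iff {x : ℝ} (D : Set ℝ) (i : ℕ) :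
    gaussMap^[i] x ∈ digitSet 0 ∩ gaussMap ⁻¹' D ↔ cfDigit x i = 1 ∧ gaussMap^[i + 1] x ∈ D := by
  rw [Function.iterate_succ_apply']
  rfl

/-- Pulling `D` back past the digits prescribed by `gapPair (j + 1)`. -/
theorem gapPair_inter_ae_eq (j : ℕ) (D : Set ℝ) :
    (digitSet 0 ∩ gaussMap ⁻¹' (gaussMap^[j] ⁻¹' (digitSet 0 ∩ gaussMap ⁻¹' D)) : Set ℝ)
      =ᵐ[gaussMeasure] (gapPair (j + 1) ∩ gaussMap^[j + 2] ⁻¹' D : Set ℝ) := by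
  filter_upwards [ae_mem_Ioo_gaussMeasure] with x hx
  refine propext ?_
  have h1 := mem_digitSet_zero_inter_iff (x := x)
    (gaussMap^[j] ⁻¹' (digitSet 0 ∩ gaussMap ⁻¹' D)) 0
  have h2 := mem_digitSet_zero_inter_iff (x := x) D (j + 1)
  have h3 := iterate_mem_gapPair_iff hx (j + 1) 0
  simp only [Function.iterate_zero, id_eq, zero_add, add_zero] at h1 h3
  refine h1.trans ?_
  rw [Set.mem_preimage, ← Function.iterate_add_apply, h2]
  refine and_assoc.symm.trans ?_
  rw [← h3]
  rfl

theorem abs_gaussMeasure_gapPair_inter_sub_le {x : ℝ} (hnorm : CFNormal x) (j m : ℕ) :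
    |(gaussMeasure (gapPair (j + 1) ∩ gaussMap^[m + (j + 2)] ⁻¹' gapPair (j + 1))).toReal -
      (gaussMeasure (gapPair (j + 1))).toReal ^ 2| ≤ (11 / 12) ^ m * 4 := by
  have := isProbabilityMeasure_gaussMeasure
  have hA := measurableSet_gapPair (j + 1)
  have hinv := gaussMeasure_preimage_gapPair hnorm (j + 1) m
  have hAm : MeasurableSet (gaussMap^[m] ⁻¹' gapPair (j + 1)) := measurable_gaussMap.iterate m hA
  have hu1 := gapPair_inter_ae_eq j Set.univ
  have hu2 := gapPair_inter_ae_eq j (gaussMap^[m] ⁻¹' gapPair (j + 1))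
  have hcomp : gaussMap^[j + 2] ⁻¹' (gaussMap^[m] ⁻¹' gapPair (j + 1)) =
      gaussMap^[m + (j + 2)] ⁻¹' gapPair (j + 1) := by
    rw [← Set.preimage_comp, ← Function.iterate_add]
  rw [hcomp] at hu2
  rw [Set.preimage_univ (f := gaussMap^[j + 2]), Set.inter_univ] at hu1
  set A := gapPair (j + 1)
  set β := (gaussMeasure A).toReal
  set ε : ℝ := (11 / 12) ^ m * 4
  have hε : 0 ≤ ε := by positivity
  have hβ : 0 ≤ β := ENNReal.toReal_nonneg
  have hβ1 : β ≤ 1 := measureReal_le_one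
  have hstep : ∀ {D : Set ℝ}, MeasurableSet D → MeasurableSet (digitSet 0 ∩ gaussMap ⁻¹' D) :=
    fun hD => (measurableSet_digitSet 0).inter (measurable_gaussMap hD)
  have hiter : ∀ {D : Set ℝ}, MeasurableSet D → MeasurableSet (gaussMap^[j] ⁻¹' D) :=
    fun hD => measurable_gaussMap.iterate j hD
  have hlift : ∀ {c₁ c₂ : ENNReal} {D E : Set ℝ}, c₁ ≠ ⊤ → c₂ ≠ ⊤ → MeasurableSet D →
      MeasurableSet E →
      (∀ s ∈ Set.Icc (0 : ℝ) 1, c₁ * mobiusMeasure s D ≤ c₂ * mobiusMeasure s E) →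
      c₁ * gaussMeasure (digitSet 0 ∩ gaussMap ⁻¹' (gaussMap^[j] ⁻¹' (digitSet 0 ∩ gaussMap ⁻¹' D)))
      ≤ c₂ * gaussMeasure
        (digitSet 0 ∩ gaussMap ⁻¹' (gaussMap^[j] ⁻¹' (digitSet 0 ∩ gaussMap ⁻¹' E))) :=
    fun h₁ h₂ hD hE h => gaussMeasure_mono_of_mobiusMeasure h₁ h₂
      (hstep (hiter (hstep hD))) (hstep (hiter (hstep hE)))
      (mobiusMeasure_digitSet_mono (hiter (hstep hD)) (hiter (hstep hE))
        (mobiusMeasure_preimage_mono (hstep hD) (hstep hE)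
          (mobiusMeasure_digitSet_mono hD hE h 0) j) 0)
  have hup := hlift (c₁ := 1) (c₂ := ENNReal.ofReal (β + ε)) ENNReal.one_ne_top
    ENNReal.ofReal_ne_top hAm MeasurableSet.univ fun s hs => by
      have := isProbabilityMeasure_mobiusMeasure hs.1
      have h := abs_le.1 (abs_mobiusMeasure_iterate_sub_le hA m hs)
      rw [one_mul, measure_univ, mul_one,
        ENNReal.le_ofReal_iff_toReal_le (measure_ne_top _ _) (by positivity)]
      linarith [h.2]
  have hlow := hlift (c₁ := ENNReal.ofReal (β - ε)) (c₂ := 1) ENNReal.ofReal_ne_top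
    ENNReal.one_ne_top MeasurableSet.univ hAm fun s hs => by
      have := isProbabilityMeasure_mobiusMeasure hs.1
      have h := abs_le.1 (abs_mobiusMeasure_iterate_sub_le hA m hs)
      rw [one_mul, measure_univ, mul_one]
      exact ENNReal.ofReal_le_of_le_toReal (by linarith [h.1])
  rw [one_mul, measure_congr hu1, measure_congr hu2] at hup hlow
  have hup' := ENNReal.toReal_mono (by finiteness) hup
  have hlow' := ENNReal.toReal_mono (measure_ne_top _ _) hlow
  rw [ENNReal.toReal_mul, ENNReal.toReal_ofReal (by positivity)] at hup'
  rw [ENNReal.toReal_mul] at hlow'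
  have hmax : β - ε ≤ (ENNReal.ofReal (β - ε)).toReal := by
    rw [ENNReal.toReal_ofReal']
    exact le_max_left _ _
  have hlow'' := (mul_le_mul_of_nonneg_right hmax hβ).trans hlow'
  have h5 : ε * β ≤ ε := mul_le_of_le_one_right hε hβ1
  rw [abs_le]
  constructor
  · nlinarith
  · nlinarith

theorem tendsto_gaussMeasure_gapPair_inter {x : ℝ} (hnorm : CFNormal x) (j : ℕ) :
    Tendsto (fun d => (gaussMeasure (gapPair (j + 1) ∩ gaussMap^[d] ⁻¹' gapPair (j + 1))).toReal)
      atTop (nhds ((gaussMeasure (gapPair (j + 1))).toReal ^ 2)) := by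
  rw [← tendsto_add_atTop_iff_nat (j + 2), tendsto_iff_norm_sub_tendsto_zero]
  refine squeeze_zero (fun _ => norm_nonneg _)
    (fun m => abs_gaussMeasure_gapPair_inter_sub_le hnorm j m) ?_
  simpa using (tendsto_pow_atTop_nhds_zero_of_lt_one (by norm_num)
    (by norm_num : (11 / 12 : ℝ) < 1)).mul_const 4

theorem tendsto_average_visit_gapPair_progression {x : ℝ} (hnorm : CFNormal x) {k r : ℕ}
    (hr : r < k) :
    Tendsto (fun N : ℕ => (∑ i ∈ Finset.range N, visit x (gapPair k) (k * i + r)) / N) atTop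
      (nhds (gaussMeasure (gapPair k)).toReal) := by
  have := isProbabilityMeasure_gaussMeasure
  obtain ⟨j, rfl⟩ : ∃ j, k = j + 1 := ⟨k - 1, by omega⟩
  set A := gapPair (j + 1) with hAdef
  have hA : MeasurableSet A := measurableSet_gapPair _
  set β := (gaussMeasure A).toReal with hβdef
  have hβ : 0 ≤ β := ENNReal.toReal_nonneg
  have hβ1 : β ≤ 1 := measureReal_le_one
  have hconst : ∀ c : ℝ, Tendsto (fun N : ℕ => (∑ _i ∈ Finset.range N, c) / N) atTop (nhds c) := by
    intro c
    refine tendsto_const_nhds.congr' ?_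
    filter_upwards [eventually_gt_atTop 0] with N hN
    have : (N : ℝ) ≠ 0 := by exact_mod_cast hN.ne'
    simp
    field_simp
  have hdet : ∀ d, DigitDetermined (j + 1 + d + 1) (gaussMap^[d] ⁻¹' A) :=
    digitDetermined_preimage_gapPair (j + 1)
  have hfreq : Tendsto (fun N : ℕ => (∑ i ∈ Finset.range N, visit x A i) / N) atTop (nhds β) :=
    tendsto_average_visit hnorm (Nat.succ_ne_zero _) hA (hdet 0)
  have hcorr : ∀ d, Tendsto (fun N : ℕ => (∑ i ∈ Finset.range N,
      (visit x A i - β) * (visit x A (i + (j + 1) * d) - β)) / N) atTop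
      (nhds ((gaussMeasure (A ∩ gaussMap^[(j + 1) * d] ⁻¹' A)).toReal - β ^ 2)) := by
    intro d
    set e := (j + 1) * d
    have h1 := tendsto_average_visit hnorm (Nat.succ_ne_zero _)
      (hA.inter (measurable_gaussMap.iterate e hA))
      (((hdet 0).mono (by omega : j + 1 + 0 + 1 ≤ j + 1 + e + 1)).inter (hdet e))
    have h2 := tendsto_average_add (abs_visit_le x A) hfreq e
    have h3 := ((h1.sub (hfreq.const_mul β)).sub (h2.const_mul β)).add (hconst (β ^ 2))
    convert h3 using 2 with N
    · rw [mul_div_assoc', mul_div_assoc', ← sub_div, ← sub_div, ← add_div, Finset.mul_sum,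
        Finset.mul_sum, ← Finset.sum_sub_distrib, ← Finset.sum_sub_distrib,
        ← Finset.sum_add_distrib]
      congr 1
      refine Finset.sum_congr rfl fun i _ => ?_
      have hprod : visit x (A ∩ gaussMap^[e] ⁻¹' A) i = visit x A i * visit x A (i + e) := by
        rw [visit_add, visit, visit, visit, ← Set.inter_indicator_mul]
        simp
      rw [hprod]
      ring
    · ring
  have hmix : Tendsto
      (fun d => (gaussMeasure (A ∩ gaussMap^[(j + 1) * d] ⁻¹' A)).toReal - β ^ 2) atTop
      (nhds 0) := by
    have h := (tendsto_gaussMeasure_gapPair_inter hnorm j).comp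
      (tendsto_id.const_mul_atTop' (Nat.succ_pos j))
    rw [← sub_self (β ^ 2)]
    exact h.sub_const (β ^ 2)
  have hmain := tendsto_average_progression (a := fun i => visit x A i - β) (fun i => by
    have h0 := visit_nonneg x A i
    have h1 := visit_le_one x A i
    rw [abs_le]
    constructor <;> linarith) hr hcorr hmix
  have := hmain.add (hconst β)
  rw [zero_add] at this
  refine this.congr fun N => ?_
  rw [← add_div, ← Finset.sum_add_distrib]
  simp only [sub_add_cancel]

theorem pattern_frequency_in_subsequence (x : ℝ) (hx : x ∈ Set.Ioo (0:ℝ) 1)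
    (hnorm : CFNormal x) (k : ℕ) (hk : 2 ≤ k) :
    Tendsto (fun n : ℕ =>
        (Nat.card {i : ℕ // 1 ≤ i ∧ i ≤ n ∧ cfDigit x (i * k - 1) = 1 ∧
            cfDigit x ((i + 1) * k - 1) = 1} : ℝ) / n)
      atTop
      (nhds (gaussMeasure (cylinder [1] ∩ (gaussMap^[k]) ⁻¹' cylinder [1])).toReal) := by
  refine (tendsto_average_visit_gapPair_progression hnorm (k := k) (r := k - 1)
    (by omega)).congr fun n => ?_
  have hpos : ∀ i, (i + 1) * k - 1 = k * i + (k - 1) := fun i => by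
    rw [Nat.add_one_mul, mul_comm i k]
    omega
  have hpos' : ∀ i, (i + 1 + 1) * k - 1 = k + (k * i + (k - 1)) := fun i => by
    rw [hpos, Nat.mul_succ]
    omega
  have hcard : Nat.card {i : ℕ // 1 ≤ i ∧ i ≤ n ∧ cfDigit x (i * k - 1) = 1 ∧
      cfDigit x ((i + 1) * k - 1) = 1} =
      Nat.card {i : ℕ // i < n ∧ gaussMap^[k * i + (k - 1)] x ∈ gapPair k} := by
    have hmem : ∀ i : {i : ℕ // i < n ∧ gaussMap^[k * i + (k - 1)] x ∈ gapPair k},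
        1 ≤ i.1 + 1 ∧ i.1 + 1 ≤ n ∧ cfDigit x ((i.1 + 1) * k - 1) = 1 ∧
          cfDigit x ((i.1 + 1 + 1) * k - 1) = 1 := by
      rintro ⟨i, h1, h2⟩
      rw [iterate_mem_gapPair_iff hx] at h2
      rw [hpos, hpos']
      exact ⟨by omega, h1, h2⟩
    refine (Nat.card_congr (Equiv.ofBijective (fun i => ⟨i.1 + 1, hmem i⟩) ⟨?_, ?_⟩)).symm
    · intro i i' h
      exact Subtype.ext (Nat.succ_injective (congrArg Subtype.val h))
    · rintro ⟨i, h1, h2, h3, h4⟩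
      obtain ⟨i, rfl⟩ : ∃ j, i = j + 1 := ⟨i - 1, by omega⟩
      rw [hpos] at h3
      rw [hpos'] at h4
      exact ⟨⟨i, by omega, (iterate_mem_gapPair_iff hx _ _).2 ⟨h3, h4⟩⟩, rfl⟩
  rw [hcard, natCard_eq_sum_indicator]
  rfl
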